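/- Let Δ > 0 and let f : ℝ → ℝ be measurable such that the function u ↦ ∑_{j=−∞}^∞ |f(u + Δj)| belongs to L²([0,Δ]). Then ∫_ℝ |f(u)| ∑_{k=1}^∞ |f(Δk + u)| du ≤ ∫₀^Δ (∑_{j=−∞}^∞ |f(u + Δj)|)² du < ∞. -/

import Mathlib

open MeasureTheory

/-- The integral over the line is the integral over one period of the periodization. -/
theorem lintegral_eq_lintegral_Icc_tsum_add_mul {Δ : ℝ} (hΔ : 0 < Δ) {g : ℝ → ENNReal}
    (hg : Measurable g) :
    ∫⁻ u, g u = ∫⁻ u in Set.Icc 0 Δ, ∑' j : ℤ, g (u + Δ * j) := by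
  rw [lintegral_tsum (fun j => by fun_prop), ← setLIntegral_univ, ← iUnion_Ioc_add_zsmul hΔ 0,
    lintegral_iUnion (fun _ => measurableSet_Ioc) (Set.pairwise_disjoint_Ioc_add_zsmul 0 Δ)]
  refine tsum_congr fun j => ?_
  rw [setLIntegral_congr (Ioc_ae_eq_Icc (a := 0) (b := Δ) (μ := volume)).symm,
    ← (measurePreserving_add_right volume (Δ * j)).setLIntegral_comp_preimage
      measurableSet_Ioc hg]
  congr 2
  simp only [Set.preimage_add_const_Ioc, zsmul_eq_mul]
  congr 1 <;> push_cast <;> ring_nf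

/-- **Remark after Theorem 3.2.** If the `Δ`-periodization `u ↦ ∑_{j ∈ ℤ} |f(u + Δ j)|`
is square integrable on `[0, Δ]`, then
`∫ |f(u)| ∑_{k=1}^∞ |f(Δ k + u)| du ≤ ∫₀^Δ (∑_{j ∈ ℤ} |f(u + Δ j)|)² du < ∞`. -/
theorem lattice_condition_of_periodization_sq_integrable
    (Δ : ℝ) (hΔ : 0 < Δ)
    (f : ℝ → ℝ) (hf : Measurable f)
    (hL2 : (∫⁻ u in Set.Icc 0 Δ,
        (∑' j : ℤ, ENNReal.ofReal |f (u + Δ * j)|) ^ 2) < ⊤) :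
    (∫⁻ u, ENNReal.ofReal |f u| * ∑' k : ℕ, ENNReal.ofReal |f (Δ * (k + 1) + u)|) ≤
      (∫⁻ u in Set.Icc 0 Δ, (∑' j : ℤ, ENNReal.ofReal |f (u + Δ * j)|) ^ 2) ∧
    (∫⁻ u, ENNReal.ofReal |f u| * ∑' k : ℕ, ENNReal.ofReal |f (Δ * (k + 1) + u)|) < ⊤ := by
  refine (fun h => ⟨h, h.trans_lt hL2⟩) ?_
  have habs : Measurable fun u => ENNReal.ofReal |f u| := hf.abs.ennreal_ofReal
  have hmeas : Measurable fun u =>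
      ENNReal.ofReal |f u| * ∑' k : ℕ, ENNReal.ofReal |f (Δ * (k + 1) + u)| :=
    habs.mul (Measurable.tsum fun k => habs.comp (measurable_const_add (Δ * ((k : ℝ) + 1))))
  rw [lintegral_eq_lintegral_Icc_tsum_add_mul hΔ hmeas]
  refine lintegral_mono fun u => ?_
  rw [sq, ← ENNReal.tsum_mul_right]
  refine ENNReal.tsum_le_tsum fun j => ?_
  gcongr
  have hinj : Function.Injective fun k : ℕ => j + (k + 1 : ℤ) := fun a b h => by
    simpa using h
  refine le_trans (le_of_eq (tsum_congr fun k => ?_))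
    (ENNReal.tsum_comp_le_tsum_of_injective hinj fun i : ℤ => ENNReal.ofReal |f (u + Δ * i)|)
  push_cast
  ring_nf
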